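/- arXiv:2511.04999 — 4 statements merged into one kernel-verified Lean document; each statement's English description precedes it below -/
import Mathlib

section
/- Assume |α_l|² ∉ {k_p², k_s²} for all l ∈ (2πℤ)². Then the three-dimensional quasi-biperiodic Green's function of the Lamé system satisfies the point-source reciprocity relation G̊^{α}(x, y) = G̊^{−α}(y, x) for all x, y ∈ ℝ³ with x₃ ≠ y₃ (so that both series converge), where −α = (−α₁, −α₂) and G̊^{−α} is defined by the same formulas with α replaced by −α. -/
noncomputable section

open Complex

/-- `e^{i a}` for a real number `a`. -/
def eI (a : ℝ) : ℂ := Complex.exp (Complex.I * (a : ℂ))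

/-- `e^{a}` for a real number `a`, viewed as a complex number. -/
def eR (a : ℝ) : ℂ := ((Real.exp a : ℝ) : ℂ)

/-- Square of the compressional wavenumber `k_p² = ρω²/(λ+2μ)`. -/
def kp2' (lam mu rho omega : ℝ) : ℝ := rho * omega ^ 2 / (lam + 2 * mu)

/-- Square of the shear wavenumber `k_s² = ρω²/μ`. -/
def ks2' (lam mu rho omega : ℝ) : ℝ := rho * omega ^ 2 / mu

/-- The 3×3 coefficient matrix `c(β; t)` of the three-dimensional quasi-biperiodic Green's
function of the Lamé system, in the regime determined by `|β|²` relative to `k_p²` and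
`k_s²`.  In the "A"-profiles the replacement `e^{−γ|t|} ↦ i e^{iγ|t|}` and in the
"B"-profiles the replacement `e^{−γ|t|} ↦ e^{iγ|t|}` is performed in the propagating
regimes, following Cases I–III. -/
def cmat3 (lam mu rho omega : ℝ) (beta : ℝ × ℝ) (t : ℝ) : Matrix (Fin 3) (Fin 3) ℂ :=
  let a : ℝ := beta.1 ^ 2 + beta.2 ^ 2
  let gp : ℝ := Real.sqrt |a - kp2' lam mu rho omega|
  let gs : ℝ := Real.sqrt |a - ks2' lam mu rho omega|
  let As : ℂ := if a < ks2' lam mu rho omega then Complex.I * eI (gs * |t|) else eR (-(gs * |t|))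
  let Bs : ℂ := if a < ks2' lam mu rho omega then eI (gs * |t|) else eR (-(gs * |t|))
  let Ap : ℂ := if a < kp2' lam mu rho omega then Complex.I * eI (gp * |t|) else eR (-(gp * |t|))
  let Bp : ℂ := if a < kp2' lam mu rho omega then eI (gp * |t|) else eR (-(gp * |t|))
  let w : ℝ := rho * omega ^ 2
  let c11 : ℂ := ((1 / (8 * Real.pi ^ 2) : ℝ) : ℂ) *
      (-((1 / mu : ℝ) : ℂ) * As / (gs : ℂ) +
        ((beta.1 ^ 2 / w : ℝ) : ℂ) * (As / (gs : ℂ) - Ap / (gp : ℂ)))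
  let c22 : ℂ := ((1 / (8 * Real.pi ^ 2) : ℝ) : ℂ) *
      (-((1 / mu : ℝ) : ℂ) * As / (gs : ℂ) +
        ((beta.2 ^ 2 / w : ℝ) : ℂ) * (As / (gs : ℂ) - Ap / (gp : ℂ)))
  let c12 : ℂ := ((beta.1 * beta.2 / (8 * Real.pi ^ 2 * w) : ℝ) : ℂ) *
      (As / (gs : ℂ) - Ap / (gp : ℂ))
  let c13 : ℂ := Complex.I * ((beta.1 / (8 * Real.pi ^ 2 * w) : ℝ) : ℂ) *
      ((Real.sign t : ℝ) : ℂ) * (Bs - Bp)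
  let c23 : ℂ := Complex.I * ((beta.2 / (8 * Real.pi ^ 2 * w) : ℝ) : ℂ) *
      ((Real.sign t : ℝ) : ℂ) * (Bs - Bp)
  let c33 : ℂ := ((1 / (8 * Real.pi ^ 2) : ℝ) : ℂ) *
      (-((1 / mu : ℝ) : ℂ) * As / (gs : ℂ) +
        ((1 / w : ℝ) : ℂ) * ((gp : ℂ) * Ap - (gs : ℂ) * As))
  !![c11, c12, c13; c12, c22, c23; c13, c23, c33]


/-- The three-dimensional `α`-quasi-biperiodic Green's function of the Lamé system,
`G̊^α(x,y) = Σ_{l∈(2πℤ)²} e^{iα_l·(x̄−ȳ)} c_l(x₃−y₃)` with `α_l = α + 2πl`. -/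
def G3 (lam mu rho omega : ℝ) (alpha : ℝ × ℝ) (x y : ℝ × ℝ × ℝ) :
    Matrix (Fin 3) (Fin 3) ℂ :=
  ∑' l : ℤ × ℤ,
    eI ((alpha.1 + 2 * Real.pi * l.1) * (x.1 - y.1) +
        (alpha.2 + 2 * Real.pi * l.2) * (x.2.1 - y.2.1)) •
      cmat3 lam mu rho omega (alpha.1 + 2 * Real.pi * l.1, alpha.2 + 2 * Real.pi * l.2)
        (x.2.2 - y.2.2)

theorem cmat3_neg (lam mu rho omega b₁ b₂ t : ℝ) :
    cmat3 lam mu rho omega (-b₁, -b₂) (-t) = cmat3 lam mu rho omega (b₁, b₂) t := by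
  have hsign : Real.sign (-t) = -Real.sign t := by
    rcases lt_trichotomy t 0 with h | rfl | h
    · rw [Real.sign_of_neg h, Real.sign_of_pos (neg_pos.mpr h), neg_neg]
    · simp
    · rw [Real.sign_of_pos h, Real.sign_of_neg (neg_neg_of_pos h)]
  simp only [cmat3, neg_sq, abs_neg, hsign, neg_div, Complex.ofReal_neg, mul_neg,
    neg_mul, neg_neg]

/-- point-source reciprocity for the 3D quasi-biperiodic Green's function of
the Lamé system: `G̊^α(x, y) = G̊^{−α}(y, x)` whenever `x₃ ≠ y₃`. -/
theorem G3_reciprocity (lam mu rho omega : ℝ) (hmu : 0 < mu) (hlm : 0 < lam + mu)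
    (hrho : 0 < rho) (homega : 0 < omega) (alpha : ℝ × ℝ)
    (hnr : ∀ l : ℤ × ℤ,
      (alpha.1 + 2 * Real.pi * l.1) ^ 2 + (alpha.2 + 2 * Real.pi * l.2) ^ 2 ≠
        kp2' lam mu rho omega ∧
      (alpha.1 + 2 * Real.pi * l.1) ^ 2 + (alpha.2 + 2 * Real.pi * l.2) ^ 2 ≠
        ks2' lam mu rho omega)
    (x y : ℝ × ℝ × ℝ) (hxy : x.2.2 ≠ y.2.2) :
    G3 lam mu rho omega alpha x y = G3 lam mu rho omega (-alpha.1, -alpha.2) y x := by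
  unfold G3
  rw [← (Equiv.neg (ℤ × ℤ)).tsum_eq]
  refine tsum_congr fun l => ?_
  simp only [Equiv.neg_apply, Prod.fst_neg, Prod.snd_neg, Int.cast_neg]
  rw [← cmat3_neg]
  congr 2 <;> ring_nf

end
end

section
/- Let λ, μ ∈ ℝ with μ > 0 and λ + μ > 0, ρ > 0, ω > 0, β ∈ ℝ, and ξ = (ξ₂, ξ₃) ∈ ℝ² with |ξ|² = ξ₂² + ξ₃². Define the real symmetric 3×3 matrix M by M₁₁ = ρω² − (λ+2μ)β² − μ|ξ|², M₂₂ = ρω² − μβ² − (λ+2μ)ξ₂² − μξ₃², M₃₃ = ρω² − μβ² − μξ₂² − (λ+2μ)ξ₃², M₁₂ = −(λ+μ)βξ₂, M₁₃ = −(λ+μ)βξ₃, M₂₃ = −(λ+μ)ξ₂ξ₃, and set D = μ(λ+2μ)(|ξ|² + β² − ρω²/(λ+2μ))(|ξ|² + β² − ρω²/μ). Then: (a) (ρω² − (λ+2μ)β² − μ|ξ|²)(ρω² − μβ² − (λ+2μ)|ξ|²) − (λ+μ)²β²|ξ|² = D; (b) M·N = D·I₃, where N is the real symmetric matrix with N₁₁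 = ρω² − μβ² − (λ+2μ)|ξ|², N₂₂ = ρω² − (λ+2μ)β² − μξ₂² − (λ+2μ)ξ₃², N₃₃ = ρω² − (λ+2μ)β² − (λ+2μ)ξ₂² − μξ₃², N₁₂ = (λ+μ)βξ₂, N₁₃ = (λ+μ)βξ₃, N₂₃ = (λ+μ)ξ₂ξ₃. In particular, if D ≠ 0 then M is invertible and M⁻¹ = N/D. -/
noncomputable section

/-- Fourier-space solution of the system defining the coefficients of the 3D
quasi-periodic Green's function of the Lamé system: with `M`, `N`, `D` as below,
(a) the determinant factorization holds, (b) `M·N = D·I₃`, and in particular if `D ≠ 0`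
then `M` is invertible with `M⁻¹ = N/D`. -/
theorem symbol_matrix_inverse_quasiperiodic
    (lam mu rho omega : ℝ) (hmu : 0 < mu) (hlm : 0 < lam + mu) (hrho : 0 < rho)
    (homega : 0 < omega) (beta xi2 xi3 : ℝ) :
    let X2 : ℝ := xi2 ^ 2 + xi3 ^ 2
    let M : Matrix (Fin 3) (Fin 3) ℝ :=
      !![rho * omega ^ 2 - (lam + 2 * mu) * beta ^ 2 - mu * X2,
          -(lam + mu) * beta * xi2, -(lam + mu) * beta * xi3;
        -(lam + mu) * beta * xi2,
          rho * omega ^ 2 - mu * beta ^ 2 - (lam + 2 * mu) * xi2 ^ 2 - mu * xi3 ^ 2,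
          -(lam + mu) * xi2 * xi3;
        -(lam + mu) * beta * xi3, -(lam + mu) * xi2 * xi3,
          rho * omega ^ 2 - mu * beta ^ 2 - mu * xi2 ^ 2 - (lam + 2 * mu) * xi3 ^ 2]
    let N : Matrix (Fin 3) (Fin 3) ℝ :=
      !![rho * omega ^ 2 - mu * beta ^ 2 - (lam + 2 * mu) * X2,
          (lam + mu) * beta * xi2, (lam + mu) * beta * xi3;
        (lam + mu) * beta * xi2,
          rho * omega ^ 2 - (lam + 2 * mu) * beta ^ 2 - mu * xi2 ^ 2 -
            (lam + 2 * mu) * xi3 ^ 2,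
          (lam + mu) * xi2 * xi3;
        (lam + mu) * beta * xi3, (lam + mu) * xi2 * xi3,
          rho * omega ^ 2 - (lam + 2 * mu) * beta ^ 2 - (lam + 2 * mu) * xi2 ^ 2 -
            mu * xi3 ^ 2]
    let D : ℝ := mu * (lam + 2 * mu) *
      (X2 + beta ^ 2 - rho * omega ^ 2 / (lam + 2 * mu)) *
      (X2 + beta ^ 2 - rho * omega ^ 2 / mu)
    ((rho * omega ^ 2 - (lam + 2 * mu) * beta ^ 2 - mu * X2) *
        (rho * omega ^ 2 - mu * beta ^ 2 - (lam + 2 * mu) * X2) -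
        (lam + mu) ^ 2 * beta ^ 2 * X2 = D) ∧
    M * N = D • (1 : Matrix (Fin 3) (Fin 3) ℝ) ∧
    (D ≠ 0 → IsUnit M ∧ M⁻¹ = D⁻¹ • N) := by
  intro X2 M N D
  have hl : lam + 2 * mu ≠ 0 := by linarith
  have hD : D = (mu * (X2 + beta ^ 2) - rho * omega ^ 2) *
      ((lam + 2 * mu) * (X2 + beta ^ 2) - rho * omega ^ 2) := by
    have h1 : mu * (rho * omega ^ 2 / mu) = rho * omega ^ 2 := mul_div_cancel₀ _ hmu.ne'
    have h2 : (lam + 2 * mu) * (rho * omega ^ 2 / (lam + 2 * mu)) = rho * omega ^ 2 :=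
      mul_div_cancel₀ _ hl
    calc D = (mu * (X2 + beta ^ 2) - mu * (rho * omega ^ 2 / mu)) *
          ((lam + 2 * mu) * (X2 + beta ^ 2) -
            (lam + 2 * mu) * (rho * omega ^ 2 / (lam + 2 * mu))) := by
          simp only [D, ← mul_sub]
          ac_rfl
      _ = _ := by rw [h1, h2]
  have hMN : M * N = D • (1 : Matrix (Fin 3) (Fin 3) ℝ) := by
    rw [hD]
    ext i j
    fin_cases i <;> fin_cases j <;>
      simp [M, N, X2, Matrix.mul_apply, Fin.sum_univ_three] <;> ring
  refine ⟨?_, hMN, fun h => ?_⟩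
  · rw [hD]
    ring
  · have hinv : M * (D⁻¹ • N) = 1 := by
      rw [Matrix.mul_smul, hMN, smul_smul, inv_mul_cancel₀ h, one_smul]
    exact ⟨IsUnit.of_mul_eq_one _ hinv, Matrix.inv_eq_right_inv hinv⟩

end
end

section
/- Let λ, μ ∈ ℝ with μ > 0 and λ + μ > 0, ρ > 0, ω > 0, a₁, a₂, ξ ∈ ℝ, and κ² = a₁² + a₂² + ξ². Define the real symmetric 3×3 matrix M by M₁₁ = ρω² − (λ+2μ)a₁² − μa₂² − μξ², M₂₂ = ρω² − (λ+2μ)a₂² − μa₁² − μξ², M₃₃ = ρω² − μ(a₁² + a₂²) − (λ+2μ)ξ², M₁₂ = −(λ+μ)a₁a₂, M₁₃ = −(λ+μ)a₁ξ, M₂₃ = −(λ+μ)a₂ξ. If κ² ≠ 0, ρω² ≠ μκ² and ρω² ≠ (λ+2μ)κ², then M is invertible and its inverse is the symmetric matrix with entries (M⁻¹)₁₁ = (1/κ²)((a₂² + ξ²)/(ρω² − μκ²) + a₁²/(ρω² − (λ+2μ)κ²)), (M⁻¹)₂₂ = (1/κ²)(a₂²/(ρω² − (λ+2μ)κ²)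 + (a₁² + ξ²)/(ρω² − μκ²)), (M⁻¹)₃₃ = (1/κ²)(ξ²/(ρω² − (λ+2μ)κ²) + (a₁² + a₂²)/(ρω² − μκ²)), (M⁻¹)₁₂ = (a₁a₂/κ²)(1/(ρω² − (λ+2μ)κ²) − 1/(ρω² − μκ²)), (M⁻¹)₁₃ = (a₁ξ/κ²)(1/(ρω² − (λ+2μ)κ²) − 1/(ρω² − μκ²)), (M⁻¹)₂₃ = (a₂ξ/κ²)(1/(ρω² − (λ+2μ)κ²) − 1/(ρω² − μκ²)). -/
noncomputable section

open Matrix in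
/-- Right inverse of a symmetric rank-one perturbation `p • 1 - c • v vᵀ` of a scalar matrix,
written through its eigenvalues `p` on `v^⊥` and `p - c * (v ⬝ᵥ v)` on the line of `v`. -/
theorem smul_one_sub_smul_vecMulVec_mul {n K : Type*} [Fintype n] [DecidableEq n] [Field K]
    {p c : K} {v : n → K} (hv : v ⬝ᵥ v ≠ 0) (hp : p ≠ 0) (hq : p - c * (v ⬝ᵥ v) ≠ 0) :
    (p • (1 : Matrix n n K) - c • vecMulVec v v) *
      (p⁻¹ • (1 : Matrix n n K) +
        ((v ⬝ᵥ v)⁻¹ * ((p - c * (v ⬝ᵥ v))⁻¹ - p⁻¹)) • vecMulVec v v) = 1 := by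
  have hvv : vecMulVec v v * vecMulVec v v = (v ⬝ᵥ v) • vecMulVec v v := by
    rw [vecMulVec_mul_vecMulVec, vecMulVec_smul]
  simp only [sub_mul, mul_add, smul_mul_assoc, mul_smul_comm, one_mul, mul_one, hvv, smul_smul]
  generalize v ⬝ᵥ v = k at *
  match_scalars
  · field_simp
  · field_simp
    ring

/-- Fourier-space solution of the system defining the coefficients of the 3D
quasi-biperiodic Green's function of the Lamé system: under the stated non-resonance
conditions the symbol matrix `M` is invertible with the explicit symmetric inverse. -/
theorem symbol_matrix_inverse_biperiodic
    (lam mu rho omega : ℝ) (hmu : 0 < mu) (hlm : 0 < lam + mu) (hrho : 0 < rho)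
    (homega : 0 < omega) (a1 a2 xi : ℝ) :
    let k2 : ℝ := a1 ^ 2 + a2 ^ 2 + xi ^ 2
    let M : Matrix (Fin 3) (Fin 3) ℝ :=
      !![rho * omega ^ 2 - (lam + 2 * mu) * a1 ^ 2 - mu * a2 ^ 2 - mu * xi ^ 2,
          -(lam + mu) * a1 * a2, -(lam + mu) * a1 * xi;
        -(lam + mu) * a1 * a2,
          rho * omega ^ 2 - (lam + 2 * mu) * a2 ^ 2 - mu * a1 ^ 2 - mu * xi ^ 2,
          -(lam + mu) * a2 * xi;
        -(lam + mu) * a1 * xi, -(lam + mu) * a2 * xi,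
          rho * omega ^ 2 - mu * (a1 ^ 2 + a2 ^ 2) - (lam + 2 * mu) * xi ^ 2]
    let Minv : Matrix (Fin 3) (Fin 3) ℝ :=
      !![(1 / k2) * ((a2 ^ 2 + xi ^ 2) / (rho * omega ^ 2 - mu * k2) +
            a1 ^ 2 / (rho * omega ^ 2 - (lam + 2 * mu) * k2)),
          (a1 * a2 / k2) * (1 / (rho * omega ^ 2 - (lam + 2 * mu) * k2) -
            1 / (rho * omega ^ 2 - mu * k2)),
          (a1 * xi / k2) * (1 / (rho * omega ^ 2 - (lam + 2 * mu) * k2) -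
            1 / (rho * omega ^ 2 - mu * k2));
        (a1 * a2 / k2) * (1 / (rho * omega ^ 2 - (lam + 2 * mu) * k2) -
            1 / (rho * omega ^ 2 - mu * k2)),
          (1 / k2) * (a2 ^ 2 / (rho * omega ^ 2 - (lam + 2 * mu) * k2) +
            (a1 ^ 2 + xi ^ 2) / (rho * omega ^ 2 - mu * k2)),
          (a2 * xi / k2) * (1 / (rho * omega ^ 2 - (lam + 2 * mu) * k2) -
            1 / (rho * omega ^ 2 - mu * k2));
        (a1 * xi / k2) * (1 / (rho * omega ^ 2 - (lam + 2 * mu) * k2) -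
            1 / (rho * omega ^ 2 - mu * k2)),
          (a2 * xi / k2) * (1 / (rho * omega ^ 2 - (lam + 2 * mu) * k2) -
            1 / (rho * omega ^ 2 - mu * k2)),
          (1 / k2) * (xi ^ 2 / (rho * omega ^ 2 - (lam + 2 * mu) * k2) +
            (a1 ^ 2 + a2 ^ 2) / (rho * omega ^ 2 - mu * k2))]
    k2 ≠ 0 → rho * omega ^ 2 ≠ mu * k2 → rho * omega ^ 2 ≠ (lam + 2 * mu) * k2 →
      IsUnit M ∧ M⁻¹ = Minv := by
  intro k2 M Minv hk hp hq
  set v : Fin 3 → ℝ := ![a1, a2, xi] with hv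
  have hvv : v ⬝ᵥ v = k2 := by
    simp [hv, k2, dotProduct, Fin.sum_univ_three, sq]
  have hp' : rho * omega ^ 2 - mu * k2 ≠ 0 := sub_ne_zero.2 hp
  have hq_eq : rho * omega ^ 2 - mu * k2 - (lam + mu) * k2 =
      rho * omega ^ 2 - (lam + 2 * mu) * k2 := by ring
  have hq' : rho * omega ^ 2 - (lam + 2 * mu) * k2 ≠ 0 := sub_ne_zero.2 hq
  have hM : M = (rho * omega ^ 2 - mu * k2) • (1 : Matrix (Fin 3) (Fin 3) ℝ) -
      (lam + mu) • Matrix.vecMulVec v v := by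
    ext i j
    fin_cases i <;> fin_cases j <;> simp [M, hv, k2] <;> ring
  have hMinv : Minv = (rho * omega ^ 2 - mu * k2)⁻¹ • (1 : Matrix (Fin 3) (Fin 3) ℝ) +
      (k2⁻¹ * ((rho * omega ^ 2 - (lam + 2 * mu) * k2)⁻¹ - (rho * omega ^ 2 - mu * k2)⁻¹)) •
        Matrix.vecMulVec v v := by
    have hk_eq : k2 = a1 ^ 2 + a2 ^ 2 + xi ^ 2 := rfl
    clear_value k2
    simp only [Minv]
    generalize rho * omega ^ 2 - mu * k2 = p at *
    generalize rho * omega ^ 2 - (lam + 2 * mu) * k2 = q at *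
    ext i j
    fin_cases i <;> fin_cases j <;> simp [hv] <;> field_simp <;>
      rw [hk_eq] <;> ring
  have hmul : M * Minv = 1 := by
    have h := smul_one_sub_smul_vecMulVec_mul (p := rho * omega ^ 2 - mu * k2) (c := lam + mu)
      (v := v) (by rwa [hvv]) hp' (by rwa [hvv, hq_eq])
    rwa [hvv, hq_eq, ← hM, ← hMinv] at h
  exact ⟨IsUnit.of_mul_eq_one _ hmul, Matrix.inv_eq_right_inv hmul⟩

end
end

section
/- Case I inverse Fourier transform for the quasi-biperiodic Green's function: let a = α_{l,1}² + α_{l,2}² with a > k_s² (= ρω²/μ), and set γ_p = √(a − ρω²/(λ+2μ)), γ_s = √(a − ρω²/μ) (both positive). For ξ ∈ ℝ let ĉ(ξ) = (2π)^{−5/2} M(ξ)⁻¹, where M(ξ) is the symbol matrix with a₁ = α_{l,1}, a₂ = α_{l,2}, κ² = a + ξ² (so that M(ξ) is invertible for every ξ ∈ ℝ). Then for every t ∈ ℝ and all indices i, j ∈ {1, 2, 3}, the absolutely convergent integral (1/√(2π)) ∫_ℝ ĉ_{ij}(ξ) e^{iξt} dξ equals the (i, j) entry of the Case I matrix c_l(t).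 -/
noncomputable section

open Complex

open MeasureTheory

/-- The symbol matrix `M(ξ)` of the 3D quasi-biperiodic Lamé system with shifted
quasi-momentum `(a₁, a₂)` and Fourier variable `ξ` dual to `x₃`. -/
def symbolM (lam mu rho omega a1 a2 xi : ℝ) : Matrix (Fin 3) (Fin 3) ℝ :=
  !![rho * omega ^ 2 - (lam + 2 * mu) * a1 ^ 2 - mu * a2 ^ 2 - mu * xi ^ 2,
      -(lam + mu) * a1 * a2, -(lam + mu) * a1 * xi;
    -(lam + mu) * a1 * a2,
      rho * omega ^ 2 - (lam + 2 * mu) * a2 ^ 2 - mu * a1 ^ 2 - mu * xi ^ 2,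
      -(lam + mu) * a2 * xi;
    -(lam + mu) * a1 * xi, -(lam + mu) * a2 * xi,
      rho * omega ^ 2 - mu * (a1 ^ 2 + a2 ^ 2) - (lam + 2 * mu) * xi ^ 2]

/-- The function `H` has absolutely convergent inverse Fourier integral `∫ H(ξ) e^{iξt} dξ = c`
at `t`. -/
def HasFourierIntegralAt (H : ℝ → ℂ) (t : ℝ) (c : ℂ) : Prop :=
  Integrable (fun xi : ℝ => H xi * Complex.exp (Complex.I * (xi : ℂ) * (t : ℂ))) ∧
    ∫ xi : ℝ, H xi * Complex.exp (Complex.I * (xi : ℂ) * (t : ℂ)) = c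

namespace HasFourierIntegralAt

variable {F G : ℝ → ℂ} {t : ℝ} {c d : ℂ}

theorem const_mul (hF : HasFourierIntegralAt F t c) (r : ℂ) :
    HasFourierIntegralAt (fun xi => r * F xi) t (r * c) := by
  simp only [HasFourierIntegralAt, mul_assoc r]
  exact ⟨hF.1.const_mul r, by rw [integral_const_mul, hF.2]⟩

theorem add (hF : HasFourierIntegralAt F t c) (hG : HasFourierIntegralAt G t d) :
    HasFourierIntegralAt (fun xi => F xi + G xi) t (c + d) := by
  simp only [HasFourierIntegralAt, add_mul]
  exact ⟨hF.1.add hG.1, by rw [integral_add hF.1 hG.1, hF.2, hG.2]⟩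

theorem sub (hF : HasFourierIntegralAt F t c) (hG : HasFourierIntegralAt G t d) :
    HasFourierIntegralAt (fun xi => F xi - G xi) t (c - d) := by
  simp only [HasFourierIntegralAt, sub_mul]
  exact ⟨hF.1.sub hG.1, by rw [integral_sub hF.1 hG.1, hF.2, hG.2]⟩

end HasFourierIntegralAt

/-- Fourier inversion on the real line, in angular frequency normalisation. -/
theorem hasFourierIntegralAt_of_fourier {h H : ℝ → ℂ} (hc : Continuous h) (hi : Integrable h)
    (hH : ∀ xi : ℝ, ∫ x : ℝ, h x * Complex.exp (-(Complex.I * xi * x)) = H xi)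
    (hHi : Integrable H) (t : ℝ) : HasFourierIntegralAt H t (2 * Real.pi * h t) := by
  have hpi : (2 * Real.pi) ≠ 0 := by positivity
  have hF : FourierTransform.fourier h = fun w : ℝ => H (2 * Real.pi * w) := by
    ext w
    rw [Real.fourier_real_eq_integral_exp_smul, ← hH]
    refine integral_congr_ae (.of_forall fun x => ?_)
    simp only [smul_eq_mul]
    rw [mul_comm]
    congr 2
    push_cast
    ring
  have hinv := hi.fourierInv_fourier_eq (hF ▸ hHi.comp_mul_left' hpi) hc.continuousAt (v := t)
  rw [Real.fourierInv_eq', hF] at hinv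
  refine ⟨hHi.mul_bdd (c := 1) (by fun_prop) (.of_forall fun xi => ?_), ?_⟩
  · rw [Complex.norm_exp]
    simp
  · have hsub := Measure.integral_comp_mul_left
      (fun xi : ℝ => H xi * Complex.exp (Complex.I * (xi : ℂ) * (t : ℂ))) (2 * Real.pi)
    rw [← hinv]
    have hcongr : (∫ w : ℝ, Complex.exp (((2 * Real.pi * inner ℝ w t : ℝ) : ℂ) * Complex.I) •
        H (2 * Real.pi * w)) = ∫ w : ℝ, H (2 * Real.pi * w) *
          Complex.exp (Complex.I * ((2 * Real.pi * w : ℝ) : ℂ) * (t : ℂ)) := by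
      refine integral_congr_ae (.of_forall fun x => ?_)
      simp only [smul_eq_mul, RCLike.inner_apply, conj_trivial]
      rw [mul_comm]
      congr 2
      push_cast
      ring
    rw [hcongr, hsub, abs_of_pos (by positivity), Complex.real_smul]
    push_cast
    rw [mul_inv_cancel_left₀ (by exact_mod_cast hpi)]

section ExponentialKernel

variable {g d : ℝ}

theorem integral_Ioi_exp_neg_abs (hg : 0 < g) (xi : ℝ) :
    IntegrableOn (fun x : ℝ => eR (-(g * |x|)) * Complex.exp (-(Complex.I * xi * x)))
      (Set.Ioi 0) ∧
    ∫ x : ℝ in Set.Ioi 0, eR (-(g * |x|)) * Complex.exp (-(Complex.I * xi * x)) =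
      1 / (g + Complex.I * xi) := by
  have hre : (-(g + Complex.I * xi) : ℂ).re < 0 := by simpa using hg
  have heq : Set.EqOn (fun x : ℝ => eR (-(g * |x|)) * Complex.exp (-(Complex.I * xi * x)))
      (fun x : ℝ => Complex.exp (-(g + Complex.I * xi) * x)) (Set.Ioi 0) := by
    intro x hx
    simp only [eR, abs_of_pos (Set.mem_Ioi.mp hx), Complex.ofReal_exp, ← Complex.exp_add]
    congr 1
    push_cast
    ring
  refine ⟨(integrableOn_exp_mul_complex_Ioi hre 0).congr_fun heq.symm measurableSet_Ioi, ?_⟩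
  rw [setIntegral_congr_fun measurableSet_Ioi heq, integral_exp_mul_complex_Ioi hre]
  simp [neg_div_neg_eq, -neg_add_rev]

theorem integral_Iic_exp_neg_abs (hg : 0 < g) (xi : ℝ) :
    IntegrableOn (fun x : ℝ => eR (-(g * |x|)) * Complex.exp (-(Complex.I * xi * x)))
      (Set.Iic 0) ∧
    ∫ x : ℝ in Set.Iic 0, eR (-(g * |x|)) * Complex.exp (-(Complex.I * xi * x)) =
      1 / (g - Complex.I * xi) := by
  have hre : 0 < (g - Complex.I * xi : ℂ).re := by simpa using hg
  have heq : Set.EqOn (fun x : ℝ => eR (-(g * |x|)) * Complex.exp (-(Complex.I * xi * x)))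
      (fun x : ℝ => Complex.exp ((g - Complex.I * xi) * x)) (Set.Iic 0) := by
    intro x hx
    simp only [eR, abs_of_nonpos (Set.mem_Iic.mp hx), Complex.ofReal_exp, ← Complex.exp_add]
    congr 1
    push_cast
    ring
  refine ⟨(integrableOn_exp_mul_complex_Iic hre 0).congr_fun heq.symm measurableSet_Iic, ?_⟩
  rw [setIntegral_congr_fun measurableSet_Iic heq, integral_exp_mul_complex_Iic hre]
  simp

theorem continuous_eR_neg_mul_abs (g : ℝ) : Continuous fun x : ℝ => eR (-(g * |x|)) := by
  unfold eR
  fun_prop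

theorem integrable_eR_neg_mul_abs (hg : 0 < g) : Integrable fun x : ℝ => eR (-(g * |x|)) := by
  have h := (integral_Iic_exp_neg_abs hg 0).1.union (integral_Ioi_exp_neg_abs hg 0).1
  rw [Set.Iic_union_Ioi, integrableOn_univ] at h
  simpa using h

theorem ofReal_add_I_mul_ne_zero (hg : 0 < g) (xi : ℝ) : (g + Complex.I * xi : ℂ) ≠ 0 := by
  intro h
  have := congrArg Complex.re h
  simp at this
  exact hg.ne' this

theorem ofReal_sub_I_mul_ne_zero (hg : 0 < g) (xi : ℝ) : (g - Complex.I * xi : ℂ) ≠ 0 := by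
  simpa [sub_eq_add_neg] using ofReal_add_I_mul_ne_zero hg (-xi)

theorem one_div_add_I_mul (hg : 0 < g) (xi : ℝ) :
    (1 / (g + Complex.I * xi) : ℂ) = (g - Complex.I * xi) * (1 / (xi ^ 2 + g ^ 2)) := by
  have h := ofReal_add_I_mul_ne_zero hg xi
  have h' := ofReal_sub_I_mul_ne_zero hg xi
  have hfac : (xi ^ 2 + g ^ 2 : ℂ) = (g + Complex.I * xi) * (g - Complex.I * xi) := by
    linear_combination (xi : ℂ) ^ 2 * Complex.I_sq
  rw [hfac]
  field_simp

theorem one_div_sub_I_mul (hg : 0 < g) (xi : ℝ) :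
    (1 / (g - Complex.I * xi) : ℂ) = (g + Complex.I * xi) * (1 / (xi ^ 2 + g ^ 2)) := by
  simpa [sub_eq_add_neg] using one_div_add_I_mul hg (-xi)

theorem integrable_one_div_sq_add_sq (hg : 0 < g) :
    Integrable fun xi : ℝ => (1 / (xi ^ 2 + g ^ 2) : ℂ) := by
  have h := (((integrable_inv_one_add_sq.comp_div hg.ne').const_mul (g ^ 2)⁻¹).ofReal (𝕜 := ℂ))
  refine h.congr (.of_forall fun xi => ?_)
  have : g ≠ 0 := hg.ne'
  have h' : (g ^ 2)⁻¹ * (1 + (xi / g) ^ 2)⁻¹ = 1 / (xi ^ 2 + g ^ 2) := by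
    field_simp
    ring
  simp only [h']
  simp

/-- The inverse Fourier integral of the Lorentzian. -/
theorem hasFourierIntegralAt_one_div (hg : 0 < g) (t : ℝ) :
    HasFourierIntegralAt (fun xi => 1 / (xi ^ 2 + g ^ 2)) t
      (Real.pi * (eR (-(g * |t|)) / g)) := by
  have hgc : (g : ℂ) ≠ 0 := by exact_mod_cast hg.ne'
  have h := hasFourierIntegralAt_of_fourier (H := fun xi => 2 * g * (1 / (xi ^ 2 + g ^ 2)))
    (continuous_eR_neg_mul_abs g) (integrable_eR_neg_mul_abs hg) (fun xi => ?_)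
    ((integrable_one_div_sq_add_sq hg).const_mul _) t
  · convert h.const_mul (1 / (2 * g)) using 1
    · ext xi
      field_simp
    · field_simp
  · obtain ⟨hi₁, h₁⟩ := integral_Iic_exp_neg_abs hg xi
    obtain ⟨hi₂, h₂⟩ := integral_Ioi_exp_neg_abs hg xi
    rw [← intervalIntegral.integral_Iic_add_Ioi hi₁ hi₂, h₁, h₂, one_div_add_I_mul hg,
      one_div_sub_I_mul hg]
    ring

theorem continuous_sign_mul_eR_sub (g d : ℝ) :
    Continuous fun x : ℝ => ((Real.sign x : ℝ) : ℂ) * (eR (-(g * |x|)) - eR (-(d * |x|))) := by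
  have hE := (continuous_eR_neg_mul_abs g).sub (continuous_eR_neg_mul_abs d)
  have h : Continuous fun x : ℝ => if 0 ≤ x then eR (-(g * |x|)) - eR (-(d * |x|))
      else -(eR (-(g * |x|)) - eR (-(d * |x|))) :=
    hE.if_le hE.neg continuous_const continuous_id (by rintro x rfl; simp)
  convert h using 2 with x
  rcases lt_trichotomy x 0 with hx | rfl | hx
  · simp [Real.sign_of_neg hx, hx.not_ge]
  · simp
  · simp [Real.sign_of_pos hx, hx.le]

theorem integrable_mul_one_div_sub (hg : 0 < g) (hd : 0 < d) :
    Integrable fun xi : ℝ => (xi * (1 / (xi ^ 2 + g ^ 2) - 1 / (xi ^ 2 + d ^ 2)) : ℂ) := by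
  have h := ((integrable_one_div_sq_add_sq hg).const_mul ((d ^ 2 - g ^ 2 : ℝ) : ℂ)).bdd_mul
    (f := fun xi : ℝ => ((xi / (xi ^ 2 + d ^ 2) : ℝ) : ℂ)) (c := 1 / (2 * d))
    (Continuous.aestronglyMeasurable (Complex.continuous_ofReal.comp (continuous_id.div
      (by fun_prop) fun x => by positivity)))
    (.of_forall fun xi => ?_)
  · refine h.congr (.of_forall fun xi => ?_)
    have h₁ : (xi ^ 2 + g ^ 2 : ℂ) ≠ 0 := by
      exact_mod_cast (by positivity : xi ^ 2 + g ^ 2 ≠ 0)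
    have h₂ : (xi ^ 2 + d ^ 2 : ℂ) ≠ 0 := by
      exact_mod_cast (by positivity : xi ^ 2 + d ^ 2 ≠ 0)
    push_cast
    field_simp
    ring
  · rw [Complex.norm_real, Real.norm_eq_abs, abs_div,
      abs_of_pos (by positivity : 0 < xi ^ 2 + d ^ 2),
      div_le_div_iff₀ (by positivity) (by positivity), ← sq_abs xi]
    nlinarith [sq_nonneg (|xi| - d)]

theorem hasFourierIntegralAt_mul_one_div_sub (hg : 0 < g) (hd : 0 < d) (t : ℝ) :
    HasFourierIntegralAt (fun xi => xi * (1 / (xi ^ 2 + g ^ 2) - 1 / (xi ^ 2 + d ^ 2))) t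
      (Complex.I * Real.pi *
        (((Real.sign t : ℝ) : ℂ) * (eR (-(g * |t|)) - eR (-(d * |t|))))) := by
  have hEi := (integrable_eR_neg_mul_abs hg).sub (integrable_eR_neg_mul_abs hd)
  have hcont := continuous_sign_mul_eR_sub g d
  have h := hasFourierIntegralAt_of_fourier
    (H := fun xi => -2 * Complex.I * (xi * (1 / (xi ^ 2 + g ^ 2) - 1 / (xi ^ 2 + d ^ 2))))
    hcont (hEi.mono hcont.aestronglyMeasurable (.of_forall fun x => ?_)) (fun xi => ?_)
    ((integrable_mul_one_div_sub hg hd).const_mul _) t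
  · convert h.const_mul (Complex.I / 2) using 1
    · ext xi
      linear_combination
        (xi * (1 / (xi ^ 2 + g ^ 2) - 1 / (xi ^ 2 + d ^ 2)) : ℂ) * Complex.I_sq
    · ring
  · rcases Real.sign_apply_eq x with hs | hs | hs <;> simp [hs, norm_sub_rev]
  · obtain ⟨hg₁, hg₁'⟩ := integral_Iic_exp_neg_abs hg xi
    obtain ⟨hg₂, hg₂'⟩ := integral_Ioi_exp_neg_abs hg xi
    obtain ⟨hd₁, hd₁'⟩ := integral_Iic_exp_neg_abs hd xi
    obtain ⟨hd₂, hd₂'⟩ := integral_Ioi_exp_neg_abs hd xi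
    have heq₁ : Set.EqOn (fun x : ℝ => ((Real.sign x : ℝ) : ℂ) *
        (eR (-(g * |x|)) - eR (-(d * |x|))) * Complex.exp (-(Complex.I * xi * x)))
        (fun x : ℝ => eR (-(d * |x|)) * Complex.exp (-(Complex.I * xi * x)) -
          eR (-(g * |x|)) * Complex.exp (-(Complex.I * xi * x))) (Set.Iic 0) := by
      intro x hx
      rcases (Set.mem_Iic.mp hx).lt_or_eq with hx | rfl
      · simp only [Real.sign_of_neg hx]
        push_cast
        ring
      · simp
    have heq₂ : Set.EqOn (fun x : ℝ => ((Real.sign x : ℝ) : ℂ) *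
        (eR (-(g * |x|)) - eR (-(d * |x|))) * Complex.exp (-(Complex.I * xi * x)))
        (fun x : ℝ => eR (-(g * |x|)) * Complex.exp (-(Complex.I * xi * x)) -
          eR (-(d * |x|)) * Complex.exp (-(Complex.I * xi * x))) (Set.Ioi 0) := by
      intro x hx
      simp only [Real.sign_of_pos (Set.mem_Ioi.mp hx)]
      push_cast
      ring
    rw [← intervalIntegral.integral_Iic_add_Ioi
        ((hd₁.sub hg₁).congr_fun heq₁.symm measurableSet_Iic)
        ((hg₂.sub hd₂).congr_fun heq₂.symm measurableSet_Ioi),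
      setIntegral_congr_fun measurableSet_Iic heq₁, setIntegral_congr_fun measurableSet_Ioi heq₂,
      integral_sub hd₁ hg₁, integral_sub hg₂ hd₂, hg₁', hg₂', hd₁', hd₂',
      one_div_add_I_mul hg, one_div_sub_I_mul hg, one_div_add_I_mul hd, one_div_sub_I_mul hd]
    ring

theorem hasFourierIntegralAt_sq_mul_one_div_sub (hg : 0 < g) (hd : 0 < d) (t : ℝ) :
    HasFourierIntegralAt (fun xi => xi ^ 2 * (1 / (xi ^ 2 + g ^ 2) - 1 / (xi ^ 2 + d ^ 2))) t
      (Real.pi * (d * eR (-(d * |t|)) - g * eR (-(g * |t|)))) := by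
  have hgc : (g : ℂ) ≠ 0 := by exact_mod_cast hg.ne'
  have hdc : (d : ℂ) ≠ 0 := by exact_mod_cast hd.ne'
  convert ((hasFourierIntegralAt_one_div hd t).const_mul (d ^ 2)).sub
    ((hasFourierIntegralAt_one_div hg t).const_mul (g ^ 2)) using 1
  · ext xi
    have h₁ : (xi ^ 2 + g ^ 2 : ℂ) ≠ 0 := by
      exact_mod_cast (by positivity : xi ^ 2 + g ^ 2 ≠ 0)
    have h₂ : (xi ^ 2 + d ^ 2 : ℂ) ≠ 0 := by
      exact_mod_cast (by positivity : xi ^ 2 + d ^ 2 ≠ 0)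
    field_simp
    ring
  · field_simp

end ExponentialKernel

/-- The partial fraction form of the inverse symbol, with `g` and `d` the shear and compressional
decay rates. -/
theorem symbolM_inv {lam mu rho omega a1 a2 g d : ℝ} (hmu : 0 < mu) (hlm : 0 < lam + mu)
    (hw : 0 < rho * omega ^ 2) (hg : 0 < g) (hd : 0 < d)
    (hg2 : g ^ 2 = a1 ^ 2 + a2 ^ 2 - rho * omega ^ 2 / mu)
    (hd2 : d ^ 2 = a1 ^ 2 + a2 ^ 2 - rho * omega ^ 2 / (lam + 2 * mu)) (xi : ℝ) :
    (symbolM lam mu rho omega a1 a2 xi)⁻¹ =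
      -(1 / mu * (1 / (xi ^ 2 + g ^ 2))) • (1 : Matrix (Fin 3) (Fin 3) ℝ) +
      (1 / (rho * omega ^ 2) * (1 / (xi ^ 2 + g ^ 2) - 1 / (xi ^ 2 + d ^ 2))) •
        Matrix.vecMulVec ![a1, a2, xi] ![a1, a2, xi] := by
  obtain ⟨w, hw'⟩ : ∃ w, w = rho * omega ^ 2 := ⟨_, rfl⟩
  obtain ⟨S, hS⟩ : ∃ S, S = xi ^ 2 + g ^ 2 := ⟨_, rfl⟩
  obtain ⟨P, hP⟩ : ∃ P, P = xi ^ 2 + d ^ 2 := ⟨_, rfl⟩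
  obtain ⟨L, hL⟩ : ∃ L, L = lam + 2 * mu := ⟨_, rfl⟩
  have hL0 : 0 < L := by linarith
  have hS0 : 0 < S := by rw [hS]; positivity
  have hP0 : 0 < P := by rw [hP]; positivity
  have hSw : mu * S = mu * (a1 ^ 2 + a2 ^ 2 + xi ^ 2) - w := by
    rw [hS, hg2, hw']; field_simp; ring
  have hPw : L * P = L * (a1 ^ 2 + a2 ^ 2 + xi ^ 2) - w := by
    rw [hP, hd2, hw', ← hL]; field_simp; ring
  have hr : 1 / w * (1 / S - 1 / P) = (lam + mu) / (mu * S * (L * P)) := by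
    rw [← hw'] at hw
    field_simp
    linear_combination mu * hPw - L * hSw + w * hL
  rw [← hS, ← hP, ← hw', hr]
  have hM : symbolM lam mu rho omega a1 a2 xi = -(mu * S) • (1 : Matrix (Fin 3) (Fin 3) ℝ) -
      (lam + mu) • Matrix.vecMulVec ![a1, a2, xi] ![a1, a2, xi] := by
    ext i j
    fin_cases i <;> fin_cases j <;>
      simp [symbolM, ← hw'] <;> linarith [hSw]
  apply Matrix.inv_eq_right_inv
  have hsq : Matrix.vecMulVec ![a1, a2, xi] ![a1, a2, xi] *
      Matrix.vecMulVec ![a1, a2, xi] ![a1, a2, xi] =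
      (a1 ^ 2 + a2 ^ 2 + xi ^ 2) • Matrix.vecMulVec ![a1, a2, xi] ![a1, a2, xi] := by
    rw [Matrix.vecMulVec_mul_vecMulVec]
    ext i j
    fin_cases i <;> fin_cases j <;> simp [dotProduct, Fin.sum_univ_three] <;> ring
  rw [hM]
  simp only [sub_mul, mul_add, smul_mul_assoc, mul_smul_comm, one_mul, mul_one, hsq]
  match_scalars
  · field_simp
  · field_simp
    linear_combination (lam + mu) * (hPw - hSw + (a1 ^ 2 + a2 ^ 2 + xi ^ 2) * hL)

/-- Case I inverse Fourier transform for the quasi-biperiodic Green's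
function: for `|α_l|² > k_s²`, the one-dimensional inverse Fourier transform
`(1/√(2π)) ∫_ℝ ĉ_{ij}(ξ) e^{iξt} dξ` of `ĉ(ξ) = (2π)^{−5/2} M(ξ)⁻¹` is absolutely
convergent and equals the `(i,j)` entry of the Case I coefficient matrix `c_l(t)`. -/
theorem caseI_inverse_fourier (lam mu rho omega : ℝ)
    (hmu : 0 < mu) (hlm : 0 < lam + mu) (hrho : 0 < rho) (homega : 0 < omega)
    (beta : ℝ × ℝ) (hI : ks2' lam mu rho omega < beta.1 ^ 2 + beta.2 ^ 2)
    (t : ℝ) (i j : Fin 3) :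
    Integrable (fun xi : ℝ =>
      ((((2 * Real.pi) ^ (-(5 : ℝ) / 2) *
          ((symbolM lam mu rho omega beta.1 beta.2 xi)⁻¹ i j) : ℝ) : ℂ) *
        Complex.exp (Complex.I * (xi : ℂ) * (t : ℂ)))) ∧
    ((1 / Real.sqrt (2 * Real.pi) : ℝ) : ℂ) *
      (∫ xi : ℝ,
        ((((2 * Real.pi) ^ (-(5 : ℝ) / 2) *
            ((symbolM lam mu rho omega beta.1 beta.2 xi)⁻¹ i j) : ℝ) : ℂ) *
          Complex.exp (Complex.I * (xi : ℂ) * (t : ℂ)))) =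
      cmat3 lam mu rho omega beta t i j := by
  have hl2 : 0 < lam + 2 * mu := by linarith
  have hw : 0 < rho * omega ^ 2 := by positivity
  have hkp : kp2' lam mu rho omega < beta.1 ^ 2 + beta.2 ^ 2 :=
    (div_le_div_of_nonneg_left hw.le hmu (by linarith)).trans_lt hI
  have hgs : 0 < beta.1 ^ 2 + beta.2 ^ 2 - ks2' lam mu rho omega := sub_pos.mpr hI
  have hgp : 0 < beta.1 ^ 2 + beta.2 ^ 2 - kp2' lam mu rho omega := sub_pos.mpr hkp
  simp only [cmat3, if_neg hI.not_gt, if_neg hkp.not_gt, abs_of_pos hgs, abs_of_pos hgp]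
  obtain ⟨g, hg, hg2⟩ : ∃ g, g = √(beta.1 ^ 2 + beta.2 ^ 2 - ks2' lam mu rho omega) ∧
      g ^ 2 = beta.1 ^ 2 + beta.2 ^ 2 - ks2' lam mu rho omega := ⟨_, rfl, Real.sq_sqrt hgs.le⟩
  obtain ⟨d, hd, hd2⟩ : ∃ d, d = √(beta.1 ^ 2 + beta.2 ^ 2 - kp2' lam mu rho omega) ∧
      d ^ 2 = beta.1 ^ 2 + beta.2 ^ 2 - kp2' lam mu rho omega := ⟨_, rfl, Real.sq_sqrt hgp.le⟩
  have hg0 : 0 < g := hg ▸ Real.sqrt_pos.mpr hgs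
  have hd0 : 0 < d := hd ▸ Real.sqrt_pos.mpr hgp
  rw [← hg, ← hd]
  simp only [symbolM_inv hmu hlm hw hg0 hd0 hg2 hd2]
  have hS := hasFourierIntegralAt_one_div hg0 t
  have hD := hS.sub (hasFourierIntegralAt_one_div hd0 t)
  have hX := hasFourierIntegralAt_mul_one_div_sub hg0 hd0 t
  have hXX := hasFourierIntegralAt_sq_mul_one_div_sub hg0 hd0 t
  have hconst : ((1 / √(2 * Real.pi) : ℝ) : ℂ) * (((2 * Real.pi) ^ (-(5 : ℝ) / 2) : ℝ) : ℂ) =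
      1 / (8 * Real.pi ^ 3) := by
    rw [← Complex.ofReal_mul, Real.sqrt_eq_rpow, one_div, ← Real.rpow_neg (by positivity),
      ← Real.rpow_add (by positivity)]
    norm_num [Real.rpow_neg (by positivity : 0 ≤ 2 * Real.pi)]
    ring
  generalize (2 * Real.pi) ^ (-(5 : ℝ) / 2) = K at *
  have key : ∀ {H : ℝ → ℝ} {F : ℝ → ℂ} {c e : ℂ}, HasFourierIntegralAt F t c →
      (∀ xi, (H xi : ℂ) = F xi) → c / (8 * Real.pi ^ 3) = e →
      Integrable (fun xi : ℝ => ((K * H xi : ℝ) : ℂ) *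
        Complex.exp (Complex.I * (xi : ℂ) * (t : ℂ))) ∧
      ((1 / √(2 * Real.pi) : ℝ) : ℂ) * (∫ xi : ℝ, ((K * H xi : ℝ) : ℂ) *
        Complex.exp (Complex.I * (xi : ℂ) * (t : ℂ))) = e := by
    intro H F c e hF hH he
    simp only [Complex.ofReal_mul K, hH]
    obtain ⟨h₁, h₂⟩ := hF.const_mul K
    refine ⟨h₁, ?_⟩
    rw [h₂, ← mul_assoc, hconst, ← he]
    ring
  generalize rho * omega ^ 2 = w at *
  fin_cases i <;> fin_cases j
  · refine key ((hS.const_mul (-(1 / mu))).add (hD.const_mul (beta.1 ^ 2 / w))) (fun xi => ?_) ?_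
      <;> [(simp; ring); (simp; field_simp)]
  · refine key (hD.const_mul (beta.1 * beta.2 / w)) (fun xi => ?_) ?_
      <;> [(simp; ring); (simp; field_simp)]
  · refine key (hX.const_mul (beta.1 / w)) (fun xi => ?_) ?_
      <;> [(simp; ring); (simp; field_simp)]
  · refine key (hD.const_mul (beta.1 * beta.2 / w)) (fun xi => ?_) ?_
      <;> [(simp; ring); (simp; field_simp)]
  · refine key ((hS.const_mul (-(1 / mu))).add (hD.const_mul (beta.2 ^ 2 / w))) (fun xi => ?_) ?_
      <;> [(simp; ring); (simp; field_simp)]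
  · refine key (hX.const_mul (beta.2 / w)) (fun xi => ?_) ?_
      <;> [(simp; ring); (simp; field_simp)]
  · refine key (hX.const_mul (beta.1 / w)) (fun xi => ?_) ?_
      <;> [(simp; ring); (simp; field_simp)]
  · refine key (hX.const_mul (beta.2 / w)) (fun xi => ?_) ?_
      <;> [(simp; ring); (simp; field_simp)]
  · refine key ((hS.const_mul (-(1 / mu))).add (hXX.const_mul (1 / w))) (fun xi => ?_) ?_
      <;> [(simp; ring); (simp; field_simp)]

end
end
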